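/- Let M ≥ 1, μ₁,…,μ_M ∈ ℝ, σ₁,…,σ_M > 0 and ω ∈ Δ_M, and set H(y) = Σ_{m=1}^M ω_m Φ(y|μ_m,σ_m²). Then there exists a constant C' > 0 such that for all y ∈ ℝ: |log(H(y))| ≤ C'(1 + y²) and |log(1 − H(y))| ≤ C'(1 + y²). -/

import Mathlib

open MeasureTheory Set

/-- Density `φ(y|μ,σ²)` of the normal distribution with mean `μ` and variance `σ2`. -/
noncomputable def gaussDensity (μ σ2 y : ℝ) : ℝ :=
  (Real.sqrt (2 * Real.pi * σ2))⁻¹ * Real.exp (-((y - μ) ^ 2) / (2 * σ2))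

/-- Cdf `Φ(y|μ,σ²)` of the normal distribution with mean `μ` and variance `σ2`. -/
noncomputable def gaussCdf (μ σ2 y : ℝ) : ℝ := ∫ z in Iic y, gaussDensity μ σ2 z

lemma gaussDensity_eq_gaussianPDFReal (μ : ℝ) {s : ℝ} (hs : 0 ≤ s) :
    gaussDensity μ s = ProbabilityTheory.gaussianPDFReal μ ⟨s, hs⟩ := rfl

lemma gaussDensity_nonneg (μ s y : ℝ) : 0 ≤ gaussDensity μ s y := by
  unfold gaussDensity
  positivity

lemma integrable_gaussDensity (μ : ℝ) {s : ℝ} (hs : 0 < s) : Integrable (gaussDensity μ s) := by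
  rw [gaussDensity_eq_gaussianPDFReal μ hs.le]
  exact ProbabilityTheory.integrable_gaussianPDFReal _ _

lemma integral_gaussDensity (μ : ℝ) {s : ℝ} (hs : 0 < s) : ∫ y, gaussDensity μ s y = 1 := by
  rw [gaussDensity_eq_gaussianPDFReal μ hs.le]
  exact ProbabilityTheory.integral_gaussianPDFReal_eq_one μ
    (fun h => hs.ne' (congrArg NNReal.toReal h))

lemma one_sub_gaussCdf (μ : ℝ) {s : ℝ} (hs : 0 < s) (y : ℝ) :
    1 - gaussCdf μ s y = ∫ z in Ioi y, gaussDensity μ s z := by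
  have h := integral_add_compl (measurableSet_Iic (a := y)) (integrable_gaussDensity μ hs)
  rw [integral_gaussDensity μ hs, compl_Iic] at h
  rw [gaussCdf, ← h, add_sub_cancel_left]

/-- Within distance one of `y`, the density is bounded below by the exponential of a
quadratic in `y`. -/
lemma exists_exp_le_gaussDensity (μ : ℝ) {s : ℝ} (hs : 0 < s) :
    ∃ K, 0 ≤ K ∧ ∀ y z : ℝ, |z - y| ≤ 1 → Real.exp (-(K * (1 + y ^ 2))) ≤ gaussDensity μ s z := by
  set A := (Real.sqrt (2 * Real.pi * s))⁻¹ with hA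
  have hA0 : 0 < A := by positivity
  refine ⟨|Real.log A| + (4 + 2 * μ ^ 2) / (2 * s), by positivity, fun y z hz => ?_⟩
  rw [gaussDensity, ← hA, ← Real.exp_log hA0, ← Real.exp_add, Real.exp_le_exp, Real.exp_log hA0]
  have hlog : -(|Real.log A| * (1 + y ^ 2)) ≤ Real.log A := by
    nlinarith [neg_abs_le (Real.log A), mul_nonneg (abs_nonneg (Real.log A)) (sq_nonneg y)]
  have hsq : (z - μ) ^ 2 ≤ (4 + 2 * μ ^ 2) * (1 + y ^ 2) := by
    have h1 : (z - y) ^ 2 ≤ 1 := (sq_le_one_iff_abs_le_one _).2 hz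
    nlinarith [sq_nonneg (z + μ), sq_nonneg (z - 2 * y), mul_nonneg (sq_nonneg μ) (sq_nonneg y)]
  have hdiv : (z - μ) ^ 2 / (2 * s) ≤ (4 + 2 * μ ^ 2) / (2 * s) * (1 + y ^ 2) := by
    rw [div_mul_eq_mul_div]
    gcongr
  rw [neg_div]
  linarith

lemma le_setIntegral_of_le_on_Ioc {f : ℝ → ℝ} (hf : Integrable f) (hf0 : ∀ x, 0 ≤ f x)
    {c a : ℝ} (hc : ∀ x ∈ Ioc a (a + 1), c ≤ f x) {S : Set ℝ} (hS : Ioc a (a + 1) ⊆ S) :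
    c ≤ ∫ x in S, f x := by
  calc c = ∫ _ in Ioc a (a + 1), c := by simp
    _ ≤ ∫ x in Ioc a (a + 1), f x :=
      setIntegral_mono_on (by simp) hf.integrableOn measurableSet_Ioc hc
    _ ≤ ∫ x in S, f x :=
      setIntegral_mono_set hf.integrableOn (ae_of_all _ hf0) hS.eventuallyLE

lemma exists_exp_le_gaussCdf (μ : ℝ) {s : ℝ} (hs : 0 < s) :
    ∃ K, 0 ≤ K ∧ ∀ y : ℝ, Real.exp (-(K * (1 + y ^ 2))) ≤ gaussCdf μ s y ∧
      Real.exp (-(K * (1 + y ^ 2))) ≤ 1 - gaussCdf μ s y := by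
  obtain ⟨K, hK, h⟩ := exists_exp_le_gaussDensity μ hs
  refine ⟨K, hK, fun y => ⟨?_, ?_⟩⟩
  · refine le_setIntegral_of_le_on_Ioc (integrable_gaussDensity μ hs) (gaussDensity_nonneg μ s)
      (a := y - 1) (fun z hz => h y z ?_) fun z hz => ?_
    · rw [abs_le]; constructor <;> linarith [hz.1, hz.2]
    · rw [mem_Iic]; linarith [hz.2]
  · rw [one_sub_gaussCdf μ hs]
    refine le_setIntegral_of_le_on_Ioc (integrable_gaussDensity μ hs) (gaussDensity_nonneg μ s)
      (a := y) (fun z hz => h y z ?_) fun z hz => hz.1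
    rw [abs_le]; constructor <;> linarith [hz.1, hz.2]

lemma le_sum_mul_of_mem_stdSimplex {ι : Type*} [Fintype ι] {w f : ι → ℝ}
    (hw : w ∈ stdSimplex ℝ ι) {c : ℝ} (h : ∀ i, c ≤ f i) : c ≤ ∑ i, w i * f i := by
  calc c = ∑ i, w i * c := by rw [← Finset.sum_mul, hw.2, one_mul]
    _ ≤ _ := Finset.sum_le_sum fun i _ => mul_le_mul_of_nonneg_left (h i) (hw.1 i)

lemma abs_log_le_of_exp_neg_le {x t : ℝ} (h : Real.exp (-t) ≤ x) (hx : x ≤ 1) :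
    |Real.log x| ≤ t := by
  have hx0 : 0 < x := (Real.exp_pos _).trans_le h
  rw [abs_of_nonpos (Real.log_nonpos hx0.le hx)]
  linarith [(Real.le_log_iff_exp_le hx0).2 h]

/-- Example 1, quantitative bound: the log of a Gaussian-mixture cdf and of its
complement grow at most quadratically. -/
theorem gaussian_mixture_cdf_log_bound
    (M : ℕ) (hM : 0 < M) (μ : Fin M → ℝ) (σ : Fin M → ℝ) (hσ : ∀ m, 0 < σ m)
    (ω : Fin M → ℝ) (hω : ω ∈ stdSimplex ℝ (Fin M)) :
    ∃ C > 0, ∀ y : ℝ,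
      |Real.log (∑ m, ω m * gaussCdf (μ m) (σ m ^ 2) y)| ≤ C * (1 + y ^ 2) ∧
      |Real.log (1 - ∑ m, ω m * gaussCdf (μ m) (σ m ^ 2) y)| ≤ C * (1 + y ^ 2) := by
  choose K hK hbound using fun m => exists_exp_le_gaussCdf (μ m) (pow_pos (hσ m) 2)
  have hsum : 0 ≤ ∑ m, K m := Finset.sum_nonneg fun m _ => hK m
  refine ⟨∑ m, K m + 1, by linarith, fun y => ?_⟩
  have hle : ∀ m, Real.exp (-((∑ m, K m + 1) * (1 + y ^ 2))) ≤
      Real.exp (-(K m * (1 + y ^ 2))) := fun m => by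
    have hm := Finset.single_le_sum (fun i _ => hK i) (Finset.mem_univ m)
    gcongr
    linarith
  have hcompl : 1 - ∑ m, ω m * gaussCdf (μ m) (σ m ^ 2) y =
      ∑ m, ω m * (1 - gaussCdf (μ m) (σ m ^ 2) y) := by
    simp only [mul_sub, mul_one, Finset.sum_sub_distrib, hω.2]
  have h₁ := le_sum_mul_of_mem_stdSimplex hω fun m => (hle m).trans (hbound m y).1
  have h₂ := le_sum_mul_of_mem_stdSimplex hω fun m => (hle m).trans (hbound m y).2
  rw [← hcompl] at h₂
  have hpos := Real.exp_pos (-((∑ m, K m + 1) * (1 + y ^ 2)))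
  exact ⟨abs_log_le_of_exp_neg_le h₁ (by linarith), abs_log_le_of_exp_neg_le h₂ (by linarith)⟩
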